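/- Let G be a dicotic nonzugzwang scoring game and let s be a real number (viewed as the game ⟨∅^s | ∅^s⟩). Then for every t ≥ 0 the cooled game (G + s)_t equals G_t + s; in particular, σ(G + s) = σ(G). -/

import Mathlib

set_option linter.unnecessarySeqFocus false
attribute [local instance] Classical.propDecidable

inductive SGame : Type where
  | mk : List SGame → List SGame → ℝ → ℝ → SGame

namespace SGame

def num (k : ℝ) : SGame := mk [] [] k k

mutual
noncomputable def Ls : SGame → ℝ
  | mk [] _ sl _ => sl
  | mk (x :: L) _ _ _ => maxRs x L
termination_by g => sizeOf g
decreasing_by all_goals simp_wf <;> omega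
noncomputable def maxRs : SGame → List SGame → ℝ
  | x, [] => Rs x
  | x, y :: L => max (Rs x) (maxRs y L)
termination_by x L => 1 + sizeOf x + sizeOf L
decreasing_by all_goals simp_wf <;> omega
noncomputable def Rs : SGame → ℝ
  | mk _ [] _ sr => sr
  | mk _ (x :: R) _ _ => minLs x R
termination_by g => sizeOf g
decreasing_by all_goals simp_wf <;> omega
noncomputable def minLs : SGame → List SGame → ℝ
  | x, [] => Ls x
  | x, y :: L => min (Ls x) (minLs y L)
termination_by x L => 1 + sizeOf x + sizeOf L
decreasing_by all_goals simp_wf <;> omega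
end

def shift : SGame → ℝ → SGame
  | mk L R sl sr, t =>
      mk (L.attach.map fun x => shift x.1 t) (R.attach.map fun x => shift x.1 t)
        (sl + t) (sr + t)
termination_by g _ => sizeOf g
decreasing_by all_goals (simp_wf; have := List.sizeOf_lt_of_mem x.2; omega)

def neg : SGame → SGame
  | mk L R sl sr =>
      mk (R.attach.map fun x => neg x.1) (L.attach.map fun x => neg x.1) (-sr) (-sl)
termination_by g => sizeOf g
decreasing_by all_goals (simp_wf; have := List.sizeOf_lt_of_mem x.2; omega)

def add : SGame → SGame → SGame
  | mk L1 R1 sl1 sr1, mk L2 R2 sl2 sr2 =>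
      mk (L1.attach.map (fun x => add x.1 (mk L2 R2 sl2 sr2)) ++
          L2.attach.map (fun y => add (mk L1 R1 sl1 sr1) y.1))
         (R1.attach.map (fun x => add x.1 (mk L2 R2 sl2 sr2)) ++
          R2.attach.map (fun y => add (mk L1 R1 sl1 sr1) y.1))
         (sl1 + sl2) (sr1 + sr2)
termination_by g h => sizeOf g + sizeOf h
decreasing_by all_goals (simp_wf; first
  | (have := List.sizeOf_lt_of_mem x.2; omega)
  | (have := List.sizeOf_lt_of_mem y.2; omega))

/-- A game is dicotic if at every position of its game tree, Left has a move
iff Right has a move. -/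
inductive Dicotic : SGame → Prop where
  | mk {L R : List SGame} {sl sr : ℝ} :
      (L = [] ↔ R = []) → (∀ x ∈ L, Dicotic x) → (∀ x ∈ R, Dicotic x) →
      Dicotic (SGame.mk L R sl sr)

/-- A game is nonzugzwang if `Rs H ≤ Ls H` at every position `H` of its game tree. -/
inductive Nonzugzwang : SGame → Prop where
  | mk {L R : List SGame} {sl sr : ℝ} :
      Rs (SGame.mk L R sl sr) ≤ Ls (SGame.mk L R sl sr) →
      (∀ x ∈ L, Nonzugzwang x) → (∀ x ∈ R, Nonzugzwang x) →
      Nonzugzwang (SGame.mk L R sl sr)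

/-- A game is a number if it has the form ⟨∅^s | ∅^s⟩. -/
def IsNumber : SGame → Prop
  | mk L R sl sr => L = [] ∧ R = [] ∧ sl = sr

/-- The cooled game `G_t`. For a number it is the number itself; otherwise it is
`G̃_t = ⟨G^L_t − t | G^R_t + t⟩` as long as `t` is at most the temperature
`σ(G) = min {u ≥ 0 | Ls(G̃_u) = Rs(G̃_u)}`, and the (number whose value is the)
score of the frozen game afterwards. -/
noncomputable def cool : SGame → ℝ → SGame
  | mk L R sl sr, t =>
      let tl : ℝ → SGame := fun u =>
        mk (L.attach.map fun x => shift (cool x.1 u) (-u))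
           (R.attach.map fun x => shift (cool x.1 u) u) sl sr
      if L = [] ∧ R = [] ∧ sl = sr then mk L R sl sr
      else if t ≤ sInf {u : ℝ | 0 ≤ u ∧ Ls (tl u) = Rs (tl u)} then tl t
      else num (Ls (tl (sInf {u : ℝ | 0 ≤ u ∧ Ls (tl u) = Rs (tl u)})))
termination_by g _ => sizeOf g
decreasing_by all_goals (simp_wf; have := List.sizeOf_lt_of_mem x.2; omega)

/-- The game `G̃_t = ⟨G^L_t − t | G^R_t + t⟩`. -/
noncomputable def tilde : SGame → ℝ → SGame
  | mk L R sl sr, u =>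
      mk (L.attach.map fun x => shift (cool x.1 u) (-u))
         (R.attach.map fun x => shift (cool x.1 u) u) sl sr

/-- The temperature `σ(G)`: `0` for numbers, and otherwise the least `t ≥ 0`
such that `Ls(G̃_t) = Rs(G̃_t)`. -/
noncomputable def temp (G : SGame) : ℝ :=
  if IsNumber G then 0 else sInf {u : ℝ | 0 ≤ u ∧ Ls (tilde G u) = Rs (tilde G u)}

/-- `H` dominates `K` when `Rs (H − K) ≥ 0`. -/
noncomputable def Dominates (H K : SGame) : Prop := 0 ≤ Rs (H.add K.neg)

/-- Equivalence of scoring games: same Left and Right scores in any sum. -/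
def SEquiv (G H : SGame) : Prop :=
  ∀ X : SGame, Ls (X.add G) = Ls (X.add H) ∧ Rs (X.add G) = Rs (X.add H)

/-- `copies G n` is the disjunctive sum `n • G` of `n` copies of `G`. -/
def copies (G : SGame) : ℕ → SGame
  | 0 => num 0
  | 1 => G
  | n + 2 => (copies G (n + 1)).add G

/-- Disjunctive sum of a list of games. -/
def sumL : List SGame → SGame
  | [] => num 0
  | [g] => g
  | g :: g' :: gs => g.add (sumL (g' :: gs))

end SGame

namespace SGame

theorem induction_on_options {P : SGame → Prop}
    (h : ∀ L R sl sr, (∀ x ∈ L, P x) → (∀ x ∈ R, P x) → P (mk L R sl sr)) : ∀ g, P g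
  | mk L R sl sr =>
      h L R sl sr (fun x _ => induction_on_options h x) (fun x _ => induction_on_options h x)
termination_by g => sizeOf g
decreasing_by all_goals (simp_wf; have := List.sizeOf_lt_of_mem ‹_ ∈ _›; omega)

theorem shift_mk (L R : List SGame) (sl sr t : ℝ) :
    shift (mk L R sl sr) t =
      mk (L.map fun x => shift x t) (R.map fun x => shift x t) (sl + t) (sr + t) := by
  rw [shift]
  simp

theorem tilde_mk (L R : List SGame) (sl sr u : ℝ) :
    tilde (mk L R sl sr) u =
      mk (L.map fun x => shift (cool x u) (-u)) (R.map fun x => shift (cool x u) u) sl sr := by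
  rw [tilde]
  simp

theorem add_num (g : SGame) (s : ℝ) : g.add (num s) = shift g s := by
  induction g using induction_on_options with
  | h L R sl sr hL hR =>
    rw [num] at hL hR ⊢
    rw [shift_mk, add]
    simpa using ⟨hL, hR⟩

theorem shift_shift (g : SGame) (a b : ℝ) : shift (shift g a) b = shift g (a + b) := by
  induction g using induction_on_options with
  | h L R sl sr hL hR =>
    simp only [shift_mk, List.map_map, add_assoc]
    congr 1
    · exact List.map_congr_left hL
    · exact List.map_congr_left hR

theorem maxRs_map_shift (t : ℝ) (L : List SGame) (x : SGame)
    (h : ∀ y ∈ x :: L, Rs (shift y t) = Rs y + t) :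
    maxRs (shift x t) (L.map fun y => shift y t) = maxRs x L + t := by
  induction L generalizing x with
  | nil => simpa [maxRs] using h
  | cons y L ih =>
    rw [List.map_cons, maxRs, maxRs, h x (by simp), ih y fun z hz => h z (by simp_all),
      max_add_add_right]

theorem minLs_map_shift (t : ℝ) (L : List SGame) (x : SGame)
    (h : ∀ y ∈ x :: L, Ls (shift y t) = Ls y + t) :
    minLs (shift x t) (L.map fun y => shift y t) = minLs x L + t := by
  induction L generalizing x with
  | nil => simpa [minLs] using h
  | cons y L ih =>
    rw [List.map_cons, minLs, minLs, h x (by simp), ih y fun z hz => h z (by simp_all),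
      min_add_add_right]

theorem scores_shift (g : SGame) (t : ℝ) :
    Ls (shift g t) = Ls g + t ∧ Rs (shift g t) = Rs g + t := by
  induction g using induction_on_options with
  | h L R sl sr hL hR =>
    rw [shift_mk]
    constructor
    · cases L with
      | nil => simp [Ls]
      | cons x L =>
        rw [List.map_cons, Ls, Ls]
        exact maxRs_map_shift t L x fun y hy => (hL y hy).2
    · cases R with
      | nil => simp [Rs]
      | cons x R =>
        rw [List.map_cons, Rs, Rs]
        exact minLs_map_shift t R x fun y hy => (hR y hy).1

theorem isNumber_shift (g : SGame) (s : ℝ) : IsNumber (shift g s) ↔ IsNumber g := by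
  cases g
  simp [shift_mk, IsNumber]

theorem cool_eq (g : SGame) (t : ℝ) :
    cool g t = if IsNumber g then g
      else if t ≤ temp g then tilde g t
      else num (Ls (tilde g (temp g))) := by
  cases g with
  | mk L R sl sr =>
    by_cases h : IsNumber (mk L R sl sr)
    · rw [cool, if_pos h]
      exact if_pos h
    · rw [if_neg h, temp, if_neg h, cool]
      exact if_neg h

theorem shift_num (k s : ℝ) : shift (num k) s = num (k + s) := by
  simp [num, shift_mk]

theorem temp_shift_of_tilde_shift {g : SGame} {s : ℝ}
    (h : ∀ u, tilde (shift g s) u = shift (tilde g u) s) : temp (shift g s) = temp g := by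
  simp [temp, isNumber_shift, h, scores_shift]

theorem cool_shift_of_tilde_shift {g : SGame} {s : ℝ}
    (h : ∀ u, tilde (shift g s) u = shift (tilde g u) s) (t : ℝ) :
    cool (shift g s) t = shift (cool g t) s := by
  simp only [cool_eq, isNumber_shift, temp_shift_of_tilde_shift h, h, (scores_shift _ _).1]
  split_ifs <;> simp [shift_num]

theorem tilde_shift (g : SGame) (s u : ℝ) : tilde (shift g s) u = shift (tilde g u) s := by
  induction g using induction_on_options generalizing u with
  | h L R sl sr hL hR =>
    simp only [shift_mk, tilde_mk, List.map_map]
    congr 1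
    · refine List.map_congr_left fun x hx => ?_
      simp only [Function.comp_apply, cool_shift_of_tilde_shift (hL x hx), shift_shift, add_comm]
    · refine List.map_congr_left fun x hx => ?_
      simp only [Function.comp_apply, cool_shift_of_tilde_shift (hR x hx), shift_shift, add_comm]

end SGame

open SGame in
/-- Cooling commutes with translation by a number: `(G + s)_t = G_t + s`,
and in particular `σ(G + s) = σ(G)`. -/
theorem cool_add_number (G : SGame) (hdic : Dicotic G) (hnz : Nonzugzwang G) (s : ℝ) :
    (∀ t : ℝ, 0 ≤ t → cool (G.add (num s)) t = (cool G t).add (num s)) ∧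
    temp (G.add (num s)) = temp G := by
  simp only [add_num]
  exact ⟨fun t _ => cool_shift_of_tilde_shift (tilde_shift G s) t,
    temp_shift_of_tilde_shift (tilde_shift G s)⟩
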